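/- arXiv:1711.03211 — 12 statements merged into one kernel-verified Lean document; each statement's English description precedes it below -/
import Mathlib

section
/- Let u₂, x₁, x₂ be positive real numbers satisfying f₁ = 0, f₂ = 0, and f₃ = 0, where f₁ = -x₁²x₂² - 5x₂²u₂² + 3x₁²u₂ + 3x₂²u₂, f₂ = -80x₁x₂² + 10x₂³ + 20x₁² + 21x₂² + 5x₂²u₂, and f₃ = -10x₁²x₂ - 5x₂³ + 6x₁² + 5x₂². Then x₂ is a root of the polynomial f(t) = 27263765625t⁸ - 82709987500t⁷ + 94104102500t⁶ - 48116787500t⁵ + 9948352750t⁴ - 491681700t³ + 74376100t² - 1183780t + 142129. -/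
/-- Any positive solution of the polynomial system coming from the Einstein
equations on `E₆/A₄` has `x₂` a root of the degree-8 eliminant `f`. -/
theorem e6_a4_eliminant (u₂ x₁ x₂ : ℝ) (hu₂ : 0 < u₂) (hx₁ : 0 < x₁) (hx₂ : 0 < x₂)
    (h1 : -x₁ ^ 2 * x₂ ^ 2 - 5 * x₂ ^ 2 * u₂ ^ 2 + 3 * x₁ ^ 2 * u₂ + 3 * x₂ ^ 2 * u₂ = 0)
    (h2 : -80 * x₁ * x₂ ^ 2 + 10 * x₂ ^ 3 + 20 * x₁ ^ 2 + 21 * x₂ ^ 2 + 5 * x₂ ^ 2 * u₂ = 0)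
    (h3 : -10 * x₁ ^ 2 * x₂ - 5 * x₂ ^ 3 + 6 * x₁ ^ 2 + 5 * x₂ ^ 2 = 0) :
    27263765625 * x₂ ^ 8 - 82709987500 * x₂ ^ 7 + 94104102500 * x₂ ^ 6 -
      48116787500 * x₂ ^ 5 + 9948352750 * x₂ ^ 4 - 491681700 * x₂ ^ 3 +
      74376100 * x₂ ^ 2 - 1183780 * x₂ + 142129 = 0 := by
  obtain ⟨y, rfl⟩ : ∃ y, x₁ = y * x₂ := ⟨x₁ / x₂, by field_simp⟩
  have hx : x₂ ^ 2 ≠ 0 := by positivity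
  have hy : (6 - 10 * x₂) * y ^ 2 = 5 * (x₂ - 1) := by
    apply mul_left_cancel₀ hx
    linear_combination h3
  have hu : u₂ = 16 * x₂ * y - 2 * x₂ - 4 * y ^ 2 - 21 / 5 := by
    apply mul_left_cancel₀ hx
    linear_combination h2 / 5
  have he : -y ^ 2 * x₂ ^ 2 - 5 * u₂ ^ 2 + 3 * y ^ 2 * u₂ + 3 * u₂ = 0 := by
    apply mul_left_cancel₀ hx
    linear_combination h1
  have hw : (6 - 10 * x₂) * u₂ = (6 - 10 * x₂) * (16 * x₂ * y - 2 * x₂ - 21 / 5)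
      - 20 * (x₂ - 1) := by
    linear_combination (6 - 10 * x₂) * hu - 4 * hy
  generalize hv : (6 - 10 * x₂) * u₂ = w at hw
  have hq : -(6 - 10 * x₂) * (5 * (x₂ - 1)) * x₂ ^ 2 - 5 * w ^ 2 + 3 * (1 - 5 * x₂) * w = 0 := by
    subst hv
    linear_combination (6 - 10 * x₂) ^ 2 * he
      + ((6 - 10 * x₂) * x₂ ^ 2 - 3 * (6 - 10 * x₂) * u₂) * hy
  have hp : (62050 * x₂ ^ 4 - 104780 * x₂ ^ 3 + 38880 * x₂ ^ 2 + 628 * x₂ - 754 / 5)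
      + (880 * x₂ - 1840 * x₂ ^ 2 - 3200 * x₂ ^ 3) * ((6 - 10 * x₂) * y) = 0 := by
    subst hw
    linear_combination hq + 5 * (16 * x₂) ^ 2 * (6 - 10 * x₂) * hy
  linear_combination 25 / 4 *
    ((62050 * x₂ ^ 4 - 104780 * x₂ ^ 3 + 38880 * x₂ ^ 2 + 628 * x₂ - 754 / 5)
      - (880 * x₂ - 1840 * x₂ ^ 2 - 3200 * x₂ ^ 3) * ((6 - 10 * x₂) * y)) * hp
    + 25 / 4 * (880 * x₂ - 1840 * x₂ ^ 2 - 3200 * x₂ ^ 3) ^ 2 * (6 - 10 * x₂) * hy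
end

section
/- The polynomial f(t) = 27263765625t⁸ - 82709987500t⁷ + 94104102500t⁶ - 48116787500t⁵ + 9948352750t⁴ - 491681700t³ + 74376100t² - 1183780t + 142129 has exactly four real roots; these roots lie in the intervals (0.6512, 0.6514), (0.6770, 0.6772), (0.8288, 0.8289), and (0.8641, 0.8642) respectively. -/
/-- A cubic with four distinct real roots has vanishing coefficients. -/
theorem cubic_coeffs_eq_zero_of_four_roots {a b c d r₃ r₂ r₁ r₀ : ℝ}
    (hab : a < b) (hbc : b < c) (hcd : c < d)
    (ha : r₃ * a ^ 3 + r₂ * a ^ 2 + r₁ * a + r₀ = 0)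
    (hb : r₃ * b ^ 3 + r₂ * b ^ 2 + r₁ * b + r₀ = 0)
    (hc : r₃ * c ^ 3 + r₂ * c ^ 2 + r₁ * c + r₀ = 0)
    (hd : r₃ * d ^ 3 + r₂ * d ^ 2 + r₁ * d + r₀ = 0) :
    r₃ = 0 ∧ r₂ = 0 ∧ r₁ = 0 ∧ r₀ = 0 := by
  have quadratic (x : ℝ) (hx : r₃ * x ^ 3 + r₂ * x ^ 2 + r₁ * x + r₀ = 0) (hax : a < x) :
      r₃ * (x ^ 2 + a * x + a ^ 2) + r₂ * (x + a) + r₁ = 0 :=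
    mul_left_cancel₀ (sub_ne_zero.2 hax.ne') (by linear_combination hx - ha)
  have hb' := quadratic b hb hab
  have linear (x : ℝ) (hx : r₃ * x ^ 3 + r₂ * x ^ 2 + r₁ * x + r₀ = 0) (hbx : b < x) :
      r₃ * (x + a + b) + r₂ = 0 :=
    mul_left_cancel₀ (sub_ne_zero.2 hbx.ne')
      (by linear_combination quadratic x hx (hab.trans hbx) - hb')
  have hc' := linear c hc hbc
  have hd' := linear d hd (hbc.trans hcd)
  have h₃ : r₃ = 0 :=
    mul_left_cancel₀ (sub_ne_zero.2 hcd.ne') (by linear_combination hd' - hc')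
  subst h₃
  have h₂ : r₂ = 0 := by linear_combination hc'
  subst h₂
  have h₁ : r₁ = 0 := by linear_combination hb'
  subst h₁
  exact ⟨rfl, rfl, rfl, by linear_combination ha⟩

/-- A quartic whose odd coefficients are dominated by its even ones is positive. -/
theorem quartic_pos_of_sq_lt {q₄ q₃ q₂ q₁ q₀ : ℝ} (h₄ : 0 < q₄) (h₀ : 0 < q₀)
    (h₃ : q₃ ^ 2 < 2 * q₄ * q₂) (h₁ : q₁ ^ 2 < 2 * q₂ * q₀) (t : ℝ) :
    0 < q₄ * t ^ 4 + q₃ * t ^ 3 + q₂ * t ^ 2 + q₁ * t + q₀ := by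
  have upper : 0 ≤ q₄ * t ^ 2 + q₃ * t + q₂ / 2 := by
    have : 0 ≤ q₄ * (q₄ * t ^ 2 + q₃ * t + q₂ / 2) := by
      nlinarith [sq_nonneg (2 * q₄ * t + q₃)]
    exact nonneg_of_mul_nonneg_right this h₄
  have lower : 0 < q₂ / 2 * t ^ 2 + q₁ * t + q₀ := by
    have : 0 < q₀ * (q₂ / 2 * t ^ 2 + q₁ * t + q₀) := by
      rcases eq_or_ne t 0 with rfl | ht
      · nlinarith
      · nlinarith [sq_nonneg (2 * q₀ + q₁ * t), mul_lt_mul_of_pos_right h₁ (pow_two_pos_of_ne_zero ht)]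
    exact pos_of_mul_pos_right this h₀.le
  nlinarith [mul_nonneg (sq_nonneg t) upper]

/-- The product of two reals in positive intervals lies between the products of the endpoints. -/
theorem mul_mem_Ioo_of_pos {x y l u l' u' : ℝ} (hl : 0 < l) (hl' : 0 < l')
    (hx : x ∈ Set.Ioo l u) (hy : y ∈ Set.Ioo l' u') : x * y ∈ Set.Ioo (l * l') (u * u') :=
  ⟨mul_lt_mul'' hx.1 hy.1 hl.le hl'.le,
    mul_lt_mul'' hx.2 hy.2 (hl.trans hx.1).le (hl'.trans hy.1).le⟩

/-- A quartic cofactor of the eliminant is positive once the elementary symmetric functions of the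
divided roots are known approximately. -/
theorem quartic_pos_of_symmetric_bounds {e₁ e₂ e₃ e₄ q₃ q₂ q₁ q₀ : ℝ}
    (b₁ : e₁ ∈ Set.Ioo (3.02 : ℝ) 3.03) (b₂ : e₂ ∈ Set.Ioo (3.4 : ℝ) 3.42)
    (b₃ : e₃ ∈ Set.Ioo (1.69 : ℝ) 1.70) (b₄ : e₄ ∈ Set.Ioo (0.315 : ℝ) 0.317)
    (h₃ : q₃ = -82709987500 + e₁ * 27263765625)
    (h₂ : 74376100 - e₂ * q₀ + e₃ * q₁ - e₄ * q₂ = 0)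
    (h₁ : -1183780 + e₃ * q₀ - e₄ * q₁ = 0) (h₀ : 142129 - e₄ * q₀ = 0) (t : ℝ) :
    0 < 27263765625 * t ^ 4 + q₃ * t ^ 3 + q₂ * t ^ 2 + q₁ * t + q₀ := by
  have he₄ : 0 < e₄ := lt_trans (by norm_num) b₄.1
  have eq₀ : q₀ = 142129 / e₄ := by
    rw [eq_div_iff he₄.ne']
    linear_combination -h₀
  have eq₁ : -q₁ = (1183780 - e₃ * q₀) / e₄ := by
    rw [eq_div_iff he₄.ne']
    linear_combination h₁
  have eq₂ : q₂ = (74376100 - e₂ * q₀ - e₃ * -q₁) / e₄ := by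
    rw [eq_div_iff he₄.ne']
    linear_combination -h₂
  have c₀ : q₀ ∈ Set.Ioo (448000 : ℝ) 452000 := by
    rw [eq₀, Set.mem_Ioo, lt_div_iff₀ he₄, div_lt_iff₀ he₄]
    constructor <;> linarith [b₄.1, b₄.2]
  have c₁ : -q₁ ∈ Set.Ioo (1000000 : ℝ) 2000000 := by
    have h := mul_mem_Ioo_of_pos (by norm_num) (by norm_num) b₃ c₀
    rw [eq₁, Set.mem_Ioo, lt_div_iff₀ he₄, div_lt_iff₀ he₄]
    constructor <;> linarith [b₄.1, b₄.2, h.1, h.2]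
  have c₂ : 200000000 < q₂ := by
    have h := mul_mem_Ioo_of_pos (by norm_num) (by norm_num) b₂ c₀
    have h' := mul_mem_Ioo_of_pos (by norm_num) (by norm_num) b₃ c₁
    rw [eq₂, lt_div_iff₀ he₄]
    linarith [b₄.2, h.2, h'.2]
  have sq₃ : q₃ ^ 2 < 500000000 ^ 2 :=
    sq_lt_sq' (by linarith [b₁.1]) (by linarith [b₁.2])
  have sq₁ : q₁ ^ 2 < 2000000 ^ 2 := sq_lt_sq' (by linarith [c₁.2]) (by linarith [c₁.1])
  refine quartic_pos_of_sq_lt (by norm_num) (by linarith [c₀.1]) (by linarith) ?_ t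
  have := mul_lt_mul'' c₂ c₀.1 (by norm_num) (by norm_num)
  linarith

/-- The eliminant as a function of one real variable. -/
def eliminantE6A4 (t : ℝ) : ℝ :=
  27263765625 * t ^ 8 - 82709987500 * t ^ 7 + 94104102500 * t ^ 6 -
    48116787500 * t ^ 5 + 9948352750 * t ^ 4 - 491681700 * t ^ 3 +
    74376100 * t ^ 2 - 1183780 * t + 142129

theorem continuous_eliminantE6A4 : Continuous eliminantE6A4 := by
  unfold eliminantE6A4
  fun_prop

/-- Dividing out four real roots in the stated intervals leaves a positive quartic. -/
theorem eliminantE6A4_eq_zero_iff {a b c d : ℝ}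
    (ha : a ∈ Set.Ioo (0.6512 : ℝ) 0.6514) (hb : b ∈ Set.Ioo (0.6770 : ℝ) 0.6772)
    (hc : c ∈ Set.Ioo (0.8288 : ℝ) 0.8289) (hd : d ∈ Set.Ioo (0.8641 : ℝ) 0.8642)
    (fa : eliminantE6A4 a = 0) (fb : eliminantE6A4 b = 0)
    (fc : eliminantE6A4 c = 0) (fd : eliminantE6A4 d = 0) (t : ℝ) :
    eliminantE6A4 t = 0 ↔ t = a ∨ t = b ∨ t = c ∨ t = d := by
  refine ⟨fun ht => ?_, by rintro (rfl | rfl | rfl | rfl) <;> assumption⟩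
  have hp := mul_mem_Ioo_of_pos (by norm_num) (by norm_num) ha hb
  have hp' := mul_mem_Ioo_of_pos (by norm_num) (by norm_num) hc hd
  have hs : a + b ∈ Set.Ioo (1.3282 : ℝ) 1.3286 :=
    ⟨by linarith [ha.1, hb.1], by linarith [ha.2, hb.2]⟩
  have hs' : c + d ∈ Set.Ioo (1.6929 : ℝ) 1.6931 :=
    ⟨by linarith [hc.1, hd.1], by linarith [hc.2, hd.2]⟩
  obtain ⟨e₁, he₁⟩ : ∃ e, e = a + b + (c + d) := ⟨_, rfl⟩
  obtain ⟨e₂, he₂⟩ : ∃ e, e = a * b + c * d + (a + b) * (c + d) := ⟨_, rfl⟩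
  obtain ⟨e₃, he₃⟩ : ∃ e, e = (a + b) * (c * d) + a * b * (c + d) := ⟨_, rfl⟩
  obtain ⟨e₄, he₄⟩ : ∃ e, e = a * b * (c * d) := ⟨_, rfl⟩
  have b₁ : e₁ ∈ Set.Ioo (3.02 : ℝ) 3.03 := by
    constructor <;> linarith [hs.1, hs.2, hs'.1, hs'.2]
  have b₂ : e₂ ∈ Set.Ioo (3.4 : ℝ) 3.42 := by
    have h := mul_mem_Ioo_of_pos (by norm_num) (by norm_num) hs hs'
    constructor <;> linarith [h.1, h.2, hp.1, hp.2, hp'.1, hp'.2]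
  have b₃ : e₃ ∈ Set.Ioo (1.69 : ℝ) 1.70 := by
    have h := mul_mem_Ioo_of_pos (by norm_num) (by norm_num) hs hp'
    have h' := mul_mem_Ioo_of_pos (by norm_num) (by norm_num) hp hs'
    constructor <;> linarith [h.1, h.2, h'.1, h'.2]
  have b₄ : e₄ ∈ Set.Ioo (0.315 : ℝ) 0.317 := by
    have h := mul_mem_Ioo_of_pos (by norm_num) (by norm_num) hp hp'
    constructor <;> linarith [h.1, h.2]
  obtain ⟨q₃, hq₃⟩ : ∃ q, q = -82709987500 + e₁ * 27263765625 := ⟨_, rfl⟩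
  obtain ⟨q₂, hq₂⟩ : ∃ q, q = 94104102500 + e₁ * q₃ - e₂ * 27263765625 := ⟨_, rfl⟩
  obtain ⟨q₁, hq₁⟩ : ∃ q, q = -48116787500 + e₁ * q₂ - e₂ * q₃ + e₃ * 27263765625 := ⟨_, rfl⟩
  obtain ⟨q₀, hq₀⟩ : ∃ q, q = 9948352750 + e₁ * q₁ - e₂ * q₂ + e₃ * q₃ - e₄ * 27263765625 :=
    ⟨_, rfl⟩
  have division (x : ℝ) : eliminantE6A4 x =
      (x - a) * (x - b) * (x - c) * (x - d) *
        (27263765625 * x ^ 4 + q₃ * x ^ 3 + q₂ * x ^ 2 + q₁ * x + q₀) +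
      ((-491681700 + e₁ * q₀ - e₂ * q₁ + e₃ * q₂ - e₄ * q₃) * x ^ 3 +
        (74376100 - e₂ * q₀ + e₃ * q₁ - e₄ * q₂) * x ^ 2 +
        (-1183780 + e₃ * q₀ - e₄ * q₁) * x + (142129 - e₄ * q₀)) := by
    have hP : (x - a) * (x - b) * (x - c) * (x - d) =
        x ^ 4 - e₁ * x ^ 3 + e₂ * x ^ 2 - e₃ * x + e₄ := by
      rw [he₁, he₂, he₃, he₄]; ring
    rw [hP, eliminantE6A4]
    linear_combination -x ^ 7 * hq₃ - x ^ 6 * hq₂ - x ^ 5 * hq₁ - x ^ 4 * hq₀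
  obtain ⟨h₃, h₂, h₁, h₀⟩ := cubic_coeffs_eq_zero_of_four_roots
    (r₃ := -491681700 + e₁ * q₀ - e₂ * q₁ + e₃ * q₂ - e₄ * q₃)
    (r₂ := 74376100 - e₂ * q₀ + e₃ * q₁ - e₄ * q₂)
    (r₁ := -1183780 + e₃ * q₀ - e₄ * q₁) (r₀ := 142129 - e₄ * q₀)
    (ha.2.trans (lt_trans (by norm_num) hb.1)) (hb.2.trans (lt_trans (by norm_num) hc.1))
    (hc.2.trans (lt_trans (by norm_num) hd.1))
    (by linear_combination fa - division a) (by linear_combination fb - division b)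
    (by linear_combination fc - division c) (by linear_combination fd - division d)
  have hpos := quartic_pos_of_symmetric_bounds b₁ b₂ b₃ b₄ hq₃ h₂ h₁ h₀ t
  have hprod : (t - a) * (t - b) * (t - c) * (t - d) = 0 := by
    refine (mul_eq_zero.1 ?_).resolve_right hpos.ne'
    linear_combination ht - division t - t ^ 3 * h₃ - t ^ 2 * h₂ - t * h₁ - h₀
  simpa [sub_eq_zero, or_assoc] using hprod

/-- The eliminant `f` for `E₆/A₄` has exactly four real roots, lying in the
indicated intervals. -/
theorem e6_a4_eliminant_roots :
    ∃ a b c d : ℝ,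
      a ∈ Set.Ioo (0.6512 : ℝ) 0.6514 ∧
      b ∈ Set.Ioo (0.6770 : ℝ) 0.6772 ∧
      c ∈ Set.Ioo (0.8288 : ℝ) 0.8289 ∧
      d ∈ Set.Ioo (0.8641 : ℝ) 0.8642 ∧
      (∀ t : ℝ,
        27263765625 * t ^ 8 - 82709987500 * t ^ 7 + 94104102500 * t ^ 6 -
          48116787500 * t ^ 5 + 9948352750 * t ^ 4 - 491681700 * t ^ 3 +
          74376100 * t ^ 2 - 1183780 * t + 142129 = 0 ↔
        t = a ∨ t = b ∨ t = c ∨ t = d) := by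
  have hcont (s : Set ℝ) : ContinuousOn eliminantE6A4 s := continuous_eliminantE6A4.continuousOn
  obtain ⟨a, ha, fa⟩ : (0 : ℝ) ∈ eliminantE6A4 '' Set.Ioo 0.6512 0.6514 :=
    intermediate_value_Ioo' (by norm_num) (hcont _) (by norm_num [eliminantE6A4])
  obtain ⟨b, hb, fb⟩ : (0 : ℝ) ∈ eliminantE6A4 '' Set.Ioo 0.6770 0.6772 :=
    intermediate_value_Ioo (by norm_num) (hcont _) (by norm_num [eliminantE6A4])
  obtain ⟨c, hc, fc⟩ : (0 : ℝ) ∈ eliminantE6A4 '' Set.Ioo 0.8288 0.8289 :=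
    intermediate_value_Ioo' (by norm_num) (hcont _) (by norm_num [eliminantE6A4])
  obtain ⟨d, hd, fd⟩ : (0 : ℝ) ∈ eliminantE6A4 '' Set.Ioo 0.8641 0.8642 :=
    intermediate_value_Ioo (by norm_num) (hcont _) (by norm_num [eliminantE6A4])
  exact ⟨a, b, c, d, ha, hb, hc, hd, eliminantE6A4_eq_zero_iff ha hb hc hd fa fb fc fd⟩
end

section
/- There exist positive real numbers u₂, x₁, x₂ with u₂ ∈ (0.1141, 0.1142), x₁ ∈ (1.2006, 1.2007), x₂ ∈ (0.6513, 0.6514) satisfying -x₁²x₂² - 5x₂²u₂² + 3x₁²u₂ + 3x₂²u₂ = 0, -80x₁x₂² + 10x₂³ + 20x₁² + 21x₂² + 5x₂²u₂ = 0, and -10x₁²x₂ - 5x₂³ + 6x₁² + 5x₂² = 0. -/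
/-- The value of `x₂` solving the third Einstein equation when `x₁ = t * x₂`. -/
noncomputable def einsteinX (t : ℝ) : ℝ := (5 + 6 * t ^ 2) / (10 * t ^ 2 + 5)

/-- The value of `u₂` solving the second Einstein equation when `x₂ = einsteinX t` and
`x₁ = t * x₂`. -/
noncomputable def einsteinU (t : ℝ) : ℝ :=
  16 * t * einsteinX t - 2 * einsteinX t - 4 * t ^ 2 - 21 / 5

theorem continuous_einsteinX : Continuous einsteinX := by
  unfold einsteinX
  exact Continuous.div (by fun_prop) (by fun_prop) fun t => by positivity

theorem continuous_einsteinU : Continuous einsteinU := by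
  have := continuous_einsteinX
  unfold einsteinU
  fun_prop

theorem einsteinX_mul (t : ℝ) : einsteinX t * (10 * t ^ 2 + 5) = 5 + 6 * t ^ 2 :=
  div_mul_cancel₀ _ (by positivity)

/-- The first Einstein equation, divided by `x₂ ^ 2`, along the curve of common solutions of the
other two has a zero in a small interval. -/
theorem exists_einstein_root :
    ∃ t ∈ Set.Icc (1.84350625 : ℝ) 1.84350627,
      -(t * einsteinX t) ^ 2 - 5 * einsteinU t ^ 2 + 3 * (t ^ 2 + 1) * einsteinU t = 0 := by
  have hX := continuous_einsteinX
  have hU := continuous_einsteinU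
  refine intermediate_value_Icc' (by norm_num) (Continuous.continuousOn (by fun_prop)) ⟨?_, ?_⟩ <;>
    norm_num [einsteinX, einsteinU]

/-- The first positive solution of the Einstein system on `E₆/A₄`. -/
theorem e6_a4_solution_one :
    ∃ u₂ x₁ x₂ : ℝ,
      u₂ ∈ Set.Ioo (0.1141 : ℝ) 0.1142 ∧
      x₁ ∈ Set.Ioo (1.2006 : ℝ) 1.2007 ∧
      x₂ ∈ Set.Ioo (0.6513 : ℝ) 0.6514 ∧
      -x₁ ^ 2 * x₂ ^ 2 - 5 * x₂ ^ 2 * u₂ ^ 2 + 3 * x₁ ^ 2 * u₂ + 3 * x₂ ^ 2 * u₂ = 0 ∧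
      -80 * x₁ * x₂ ^ 2 + 10 * x₂ ^ 3 + 20 * x₁ ^ 2 + 21 * x₂ ^ 2 + 5 * x₂ ^ 2 * u₂ = 0 ∧
      -10 * x₁ ^ 2 * x₂ - 5 * x₂ ^ 3 + 6 * x₁ ^ 2 + 5 * x₂ ^ 2 = 0 := by
  obtain ⟨t, ⟨ht₁, ht₂⟩, h⟩ := exists_einstein_root
  have hsq₁ : (3.39851529 : ℝ) ≤ t ^ 2 := by nlinarith
  have hsq₂ : t ^ 2 ≤ 3.39851537 := by nlinarith
  have hx₁ : (0.65130158 : ℝ) ≤ einsteinX t := by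
    rw [einsteinX, le_div_iff₀ (by positivity)]; linarith
  have hx₂ : einsteinX t ≤ 0.65130159 := by
    rw [einsteinX, div_le_iff₀ (by positivity)]; linarith
  have htx₁ : (1.20067853 : ℝ) ≤ t * einsteinX t := by nlinarith
  have htx₂ : t * einsteinX t ≤ 1.20067858 := by nlinarith
  have hx := einsteinX_mul t
  refine ⟨einsteinU t, t * einsteinX t, einsteinX t, ⟨?_, ?_⟩, ⟨by linarith, by linarith⟩,
    ⟨by linarith, by linarith⟩, ?_, ?_, ?_⟩
  · unfold einsteinU; linarith
  · unfold einsteinU; linarith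
  · linear_combination einsteinX t ^ 2 * h
  · unfold einsteinU; ring
  · linear_combination (-einsteinX t ^ 2) * hx
end

section
/- There exist positive real numbers u₂, x₁, x₂ with u₂ ∈ (1.7465, 1.7466), x₁ ∈ (0.9798, 0.9799), x₂ ∈ (0.6770, 0.6772) satisfying -x₁²x₂² - 5x₂²u₂² + 3x₁²u₂ + 3x₂²u₂ = 0, -80x₁x₂² + 10x₂³ + 20x₁² + 21x₂² + 5x₂²u₂ = 0, and -10x₁²x₂ - 5x₂³ + 6x₁² + 5x₂² = 0. -/
/-- The last equation of the system is parametrized rationally by `s = x₁ / x₂`, and the second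
equation then determines `u₂`; the denominator `10 * s ^ 2 + 5` is recorded by `ht`. -/
theorem einstein_residual_of_ratio {s t u : ℝ}
    (ht : t * (10 * s ^ 2 + 5) = 5 + 6 * s ^ 2)
    (hu : u = 16 * t * s - 2 * t - 4 * s ^ 2 - 21 / 5)
    (h : s ^ 2 * t ^ 2 + 5 * u ^ 2 - 3 * (s ^ 2 + 1) * u = 0) :
    -(t * s) ^ 2 * t ^ 2 - 5 * t ^ 2 * u ^ 2 + 3 * (t * s) ^ 2 * u + 3 * t ^ 2 * u = 0 ∧
      -80 * (t * s) * t ^ 2 + 10 * t ^ 3 + 20 * (t * s) ^ 2 + 21 * t ^ 2 + 5 * t ^ 2 * u = 0 ∧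
      -10 * (t * s) ^ 2 * t - 5 * t ^ 3 + 6 * (t * s) ^ 2 + 5 * t ^ 2 = 0 := by
  refine ⟨?_, ?_, ?_⟩
  · linear_combination (-t ^ 2) * h
  · subst hu
    ring
  · linear_combination (-t ^ 2) * ht

/-- The second positive solution of the Einstein system on `E₆/A₄`. -/
theorem e6_a4_solution_two :
    ∃ u₂ x₁ x₂ : ℝ,
      u₂ ∈ Set.Ioo (1.7465 : ℝ) 1.7466 ∧
      x₁ ∈ Set.Ioo (0.9798 : ℝ) 0.9799 ∧
      x₂ ∈ Set.Ioo (0.6770 : ℝ) 0.6772 ∧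
      -x₁ ^ 2 * x₂ ^ 2 - 5 * x₂ ^ 2 * u₂ ^ 2 + 3 * x₁ ^ 2 * u₂ + 3 * x₂ ^ 2 * u₂ = 0 ∧
      -80 * x₁ * x₂ ^ 2 + 10 * x₂ ^ 3 + 20 * x₁ ^ 2 + 21 * x₂ ^ 2 + 5 * x₂ ^ 2 * u₂ = 0 ∧
      -10 * x₁ ^ 2 * x₂ - 5 * x₂ ^ 3 + 6 * x₁ ^ 2 + 5 * x₂ ^ 2 = 0 := by
  let T : ℝ → ℝ := fun s ↦ (5 + 6 * s ^ 2) / (10 * s ^ 2 + 5)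
  let U : ℝ → ℝ := fun s ↦ 16 * T s * s - 2 * T s - 4 * s ^ 2 - 21 / 5
  let F : ℝ → ℝ := fun s ↦ s ^ 2 * T s ^ 2 + 5 * U s ^ 2 - 3 * (s ^ 2 + 1) * U s
  have hpos (s : ℝ) : 0 < 10 * s ^ 2 + 5 := by positivity
  have hT : Continuous T := by
    have hne (s : ℝ) : 10 * s ^ 2 + 5 ≠ 0 := (hpos s).ne'
    fun_prop (disch := assumption)
  have hF : ContinuousOn F (Set.Icc 1.447134 1.447135) := by
    fun_prop
  obtain ⟨s, ⟨hs₁, hs₂⟩, hs⟩ : (0 : ℝ) ∈ F '' Set.Icc 1.447134 1.447135 :=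
    intermediate_value_Icc' (by norm_num) hF
      ⟨by norm_num [F, U, T], by norm_num [F, U, T]⟩
  have hsq₁ : (1.447134 : ℝ) ^ 2 ≤ s ^ 2 := by gcongr
  have hsq₂ : s ^ 2 ≤ (1.447135 : ℝ) ^ 2 := by gcongr
  have hT₁ : 0.677095 ≤ T s := by
    rw [le_div_iff₀ (hpos s)]
    norm_num at hsq₁ hsq₂ ⊢
    linarith
  have hT₂ : T s ≤ 0.6770952 := by
    rw [div_le_iff₀ (hpos s)]
    norm_num at hsq₁ hsq₂ ⊢
    linarith
  have hx₁ : 0.677095 * 1.447134 ≤ T s * s := by gcongr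
  have hx₂ : T s * s ≤ 0.6770952 * 1.447135 := by gcongr
  refine ⟨U s, T s * s, T s, ⟨?_, ?_⟩, ⟨?_, ?_⟩, ⟨?_, ?_⟩,
    einstein_residual_of_ratio (div_mul_cancel₀ _ (hpos s).ne') rfl hs⟩
  all_goals
    norm_num [U] at hsq₁ hsq₂ hT₁ hT₂ hx₁ hx₂ ⊢
    linarith
end

section
/- There exist positive real numbers u₂, x₁, x₂ with u₂ ∈ (0.7564, 0.7565), x₁ ∈ (0.5068, 0.5069), x₂ ∈ (0.8288, 0.8289) satisfying -x₁²x₂² - 5x₂²u₂² + 3x₁²u₂ + 3x₂²u₂ = 0, -80x₁x₂² + 10x₂³ + 20x₁² + 21x₂² + 5x₂²u₂ = 0, and -10x₁²x₂ - 5x₂³ + 6x₁² + 5x₂² = 0. -/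
/-- The third positive solution of the Einstein system on `E₆/A₄`. -/
theorem e6_a4_solution_three :
    ∃ u₂ x₁ x₂ : ℝ,
      u₂ ∈ Set.Ioo (0.7564 : ℝ) 0.7565 ∧
      x₁ ∈ Set.Ioo (0.5068 : ℝ) 0.5069 ∧
      x₂ ∈ Set.Ioo (0.8288 : ℝ) 0.8289 ∧
      -x₁ ^ 2 * x₂ ^ 2 - 5 * x₂ ^ 2 * u₂ ^ 2 + 3 * x₁ ^ 2 * u₂ + 3 * x₂ ^ 2 * u₂ = 0 ∧
      -80 * x₁ * x₂ ^ 2 + 10 * x₂ ^ 3 + 20 * x₁ ^ 2 + 21 * x₂ ^ 2 + 5 * x₂ ^ 2 * u₂ = 0 ∧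
      -10 * x₁ ^ 2 * x₂ - 5 * x₂ ^ 3 + 6 * x₁ ^ 2 + 5 * x₂ ^ 2 = 0 := by
  -- With `s = x₁ / x₂`, the last two equations give `x₂` and `u₂` as rational functions of `s`.
  let y : ℝ → ℝ := fun s => (5 + 6 * s ^ 2) / (5 + 10 * s ^ 2)
  let u : ℝ → ℝ := fun s => 16 * (y s * s) - 2 * y s - 21 / 5 - 4 * s ^ 2
  let g : ℝ → ℝ := fun s => -(y s * s) ^ 2 - 5 * u s ^ 2 + 3 * s ^ 2 * u s + 3 * u s
  have hpos (s : ℝ) : 0 < 5 + 10 * s ^ 2 := by positivity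
  have hy : Continuous y :=
    Continuous.div₀ (by fun_prop) (by fun_prop) fun s => (hpos s).ne'
  have hu : Continuous u := by fun_prop
  have hg : Continuous g := by fun_prop
  obtain ⟨s, ⟨hs₁, hs₂⟩, hs⟩ : (0 : ℝ) ∈ g '' Set.Icc 0.611574 0.611576 := by
    exact intermediate_value_Icc' (by norm_num) hg.continuousOn
      ⟨by norm_num [g, u, y], by norm_num [g, u, y]⟩
  have hy₁ : 0.82882 < y s := by
    rw [lt_div_iff₀ (hpos s)]
    nlinarith
  have hy₂ : y s < 0.82883 := by
    rw [div_lt_iff₀ (hpos s)]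
    nlinarith
  have hx₁ : 0.50688 < y s * s := by nlinarith
  have hx₂ : y s * s < 0.5069 := by nlinarith
  have hrel : y s * (5 + 10 * s ^ 2) = 5 + 6 * s ^ 2 := div_mul_cancel₀ _ (hpos s).ne'
  refine ⟨u s, y s * s, y s, ⟨?_, ?_⟩, ⟨by linarith, hx₂⟩, ⟨by linarith, by linarith⟩, ?_, ?_, ?_⟩
  · simp only [u]
    nlinarith
  · simp only [u]
    nlinarith
  · linear_combination y s ^ 2 * hs
  · simp only [u]
    ring
  · linear_combination -(y s ^ 2) * hrel
end

section
/- There exist positive real numbers u₂, x₁, x₂ with u₂ ∈ (0.0549, 0.0550), x₁ ∈ (0.4382, 0.4383), x₂ ∈ (0.8641, 0.8642) satisfying -x₁²x₂² - 5x₂²u₂² + 3x₁²u₂ + 3x₂²u₂ = 0, -80x₁x₂² + 10x₂³ + 20x₁² + 21x₂² + 5x₂²u₂ = 0, and -10x₁²x₂ - 5x₂³ + 6x₁² + 5x₂² = 0. -/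
/-- The fourth positive solution of the Einstein system on `E₆/A₄`. -/
theorem e6_a4_solution_four :
    ∃ u₂ x₁ x₂ : ℝ,
      u₂ ∈ Set.Ioo (0.0549 : ℝ) 0.0550 ∧
      x₁ ∈ Set.Ioo (0.4382 : ℝ) 0.4383 ∧
      x₂ ∈ Set.Ioo (0.8641 : ℝ) 0.8642 ∧
      -x₁ ^ 2 * x₂ ^ 2 - 5 * x₂ ^ 2 * u₂ ^ 2 + 3 * x₁ ^ 2 * u₂ + 3 * x₂ ^ 2 * u₂ = 0 ∧
      -80 * x₁ * x₂ ^ 2 + 10 * x₂ ^ 3 + 20 * x₁ ^ 2 + 21 * x₂ ^ 2 + 5 * x₂ ^ 2 * u₂ = 0 ∧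
      -10 * x₁ ^ 2 * x₂ - 5 * x₂ ^ 3 + 6 * x₁ ^ 2 + 5 * x₂ ^ 2 = 0 := by
  -- With `s = x₁ / x₂`, the third equation determines `x₂` and the second determines `u₂`.
  let y : ℝ → ℝ := fun s => (5 + 6 * s ^ 2) / (5 + 10 * s ^ 2)
  let u : ℝ → ℝ := fun s => (80 * s * y s - 10 * y s - 20 * s ^ 2 - 21) / 5
  let f : ℝ → ℝ := fun s => -s ^ 2 * y s ^ 2 - 5 * u s ^ 2 + 3 * s ^ 2 * u s + 3 * u s
  have hden (s : ℝ) : 5 + 10 * s ^ 2 ≠ 0 := by positivity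
  have hy : Continuous y := by fun_prop (disch := exact hden _)
  have hf : Continuous f := by fun_prop
  obtain ⟨s, ⟨hs₁, hs₂⟩, hs⟩ : (0 : ℝ) ∈ f '' Set.Icc 0.507161 0.507162 := by
    apply intermediate_value_Icc (by norm_num) hf.continuousOn
    constructor <;> norm_num [f, u, y]
  have hyd : y s * (5 + 10 * s ^ 2) = 5 + 6 * s ^ 2 := div_mul_cancel₀ _ (hden s)
  have hsq₁ : (0.507161 : ℝ) ^ 2 ≤ s ^ 2 := by gcongr
  have hsq₂ : s ^ 2 ≤ (0.507162 : ℝ) ^ 2 := by gcongr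
  have hy₁ : 0.8641263 < y s := by
    rw [lt_div_iff₀ (by positivity)]
    linarith
  have hy₂ : y s < 0.8641268 := by
    rw [div_lt_iff₀ (by positivity)]
    linarith
  have hsy₁ : 0.507161 * y s ≤ s * y s := by gcongr
  have hsy₂ : s * y s ≤ 0.507162 * y s := by gcongr
  refine ⟨u s, s * y s, y s, ⟨?_, ?_⟩, ⟨?_, ?_⟩, ⟨?_, ?_⟩, ?_, ?_, ?_⟩
  · simp only [u]
    linarith
  · simp only [u]
    linarith
  · linarith
  · linarith
  · linarith
  · linarith
  · linear_combination y s ^ 2 * hs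
  · simp only [u]
    ring
  · linear_combination -y s ^ 2 * hyd
end

section
/- The polynomial g(t) = 40733269776t⁸ - 95717471616t⁷ + 80248108328t⁶ - 31589680504t⁵ + 7669961625t⁴ - 1207801950t³ + 120201725t² - 5089500t + 422500 has exactly two real roots; these roots lie in the intervals (0.8651, 0.8652) and (0.9203, 0.9204) respectively. -/
/-- The eliminant as a function on the real line. -/
def eliminant (t : ℝ) : ℝ :=
  40733269776 * t ^ 8 - 95717471616 * t ^ 7 + 80248108328 * t ^ 6 -
      31589680504 * t ^ 5 + 7669961625 * t ^ 4 - 1207801950 * t ^ 3 +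
      120201725 * t ^ 2 - 5089500 * t + 422500

open Polynomial in
/-- The eliminant as a formal polynomial. -/
noncomputable def eliminantPoly : ℝ[X] :=
  C 40733269776 * X ^ 8 - C 95717471616 * X ^ 7 + C 80248108328 * X ^ 6 -
      C 31589680504 * X ^ 5 + C 7669961625 * X ^ 4 - C 1207801950 * X ^ 3 +
      C 120201725 * X ^ 2 - C 5089500 * X + C 422500

/-- The certificates on `[0, 2 / 5]` and `[2 / 5, 21 / 25]` are Bernstein expansions with positive
coefficients. -/
theorem eliminant_pos_of_le {t : ℝ} (ht : t ≤ 21 / 25) : 0 < eliminant t := by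
  unfold eliminant
  rcases le_or_gt t 0 with h0 | h0
  · have h : 0 ≤ -t := by linarith
    have key : 0 ≤ 40733269776 * (-t) ^ 8 + 95717471616 * (-t) ^ 7 + 80248108328 * (-t) ^ 6 +
        31589680504 * (-t) ^ 5 + 7669961625 * (-t) ^ 4 + 1207801950 * (-t) ^ 3 +
        120201725 * (-t) ^ 2 + 5089500 * (-t) := by positivity
    linarith only [key]
  rcases lt_or_ge t (2 / 5) with h1 | h1
  · have h : 0 < 2 / 5 - t := by linarith
    have key : 0 <
      41259765625 / 64 * (2 / 5 - t) ^ 8 +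
      65634765625 / 32 * t * (2 / 5 - t) ^ 7 +
      1641765234375 / 64 * t ^ 2 * (2 / 5 - t) ^ 6 +
      463928984375 / 16 * t ^ 3 * (2 / 5 - t) ^ 5 +
      5533255234375 / 64 * t ^ 4 * (2 / 5 - t) ^ 4 +
      1268799513625 / 32 * t ^ 5 * (2 / 5 - t) ^ 3 +
      2044576584825 / 64 * t ^ 6 * (2 / 5 - t) ^ 2 +
      51215385810 * t ^ 7 * (2 / 5 - t) +
      17944400536 * t ^ 8 := by
      positivity
    linarith only [key]
  rcases h1.eq_or_lt with rfl | h1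
  · norm_num
  · have hl : 0 < t - 2 / 5 := by linarith
    have hr : 0 ≤ 21 / 25 - t := by linarith
    have key : 0 <
      1794440053600000000 / 214358881 * (21 / 25 - t) ^ 8 +
      24512900461380000000 / 214358881 * (t - 2 / 5) * (21 / 25 - t) ^ 7 +
      142627706569442765625 / 214358881 * (t - 2 / 5) ^ 2 * (21 / 25 - t) ^ 6 +
      452317300907410662500 / 214358881 * (t - 2 / 5) ^ 3 * (21 / 25 - t) ^ 5 +
      829764574479071293750 / 214358881 * (t - 2 / 5) ^ 4 * (21 / 25 - t) ^ 4 +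
      854194294731688953500 / 214358881 * (t - 2 / 5) ^ 5 * (21 / 25 - t) ^ 3 +
      426437975391567676425 / 214358881 * (t - 2 / 5) ^ 6 * (21 / 25 - t) ^ 2 +
      63166843637504485880 / 214358881 * (t - 2 / 5) ^ 7 * (21 / 25 - t) +
      2298181372956846736 / 214358881 * (t - 2 / 5) ^ 8 := by
      positivity
    linarith only [key]

theorem strictConvexOn_eliminant : StrictConvexOn ℝ (Set.Ici (21 / 25)) eliminant := by
  have hcont : Continuous eliminant := by unfold eliminant; fun_prop
  refine strictConvexOn_of_deriv2_pos (convex_Ici _) hcont.continuousOn fun t ht => ?_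
  rw [interior_Ici, Set.mem_Ioi] at ht
  have h : 0 < t - 21 / 25 := by linarith
  have key : 0 < 803622287137652626 / 244140625 +
      2283822681212800836 / 9765625 * (t - 21 / 25) +
      148415419791838908 / 78125 * (t - 21 / 25) ^ 2 +
      19159550380842464 / 3125 * (t - 21 / 25) ^ 3 +
      1208206648261488 / 125 * (t - 21 / 25) ^ 4 +
      186910606342656 / 25 * (t - 21 / 25) ^ 5 +
      2281063107456 * (t - 21 / 25) ^ 6 := by
    positivity
  have hd : deriv^[2] eliminant t =
      2281063107456 * t ^ 6 - 4020133807872 * t ^ 5 + 2407443249840 * t ^ 4 -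
        631793610080 * t ^ 3 + 92039539500 * t ^ 2 -
        7246811700 * t + 240403450 := by
    have he : eliminant = fun x => eliminantPoly.eval x := by
      ext x
      simp [eliminant, eliminantPoly]
    have hderiv (p : Polynomial ℝ) : deriv (fun x => p.eval x) = fun x => p.derivative.eval x :=
      funext fun _ => p.deriv
    simp only [he, Function.iterate_succ, Function.iterate_zero, Function.comp_apply, id_eq, hderiv]
    simp [eliminantPoly]
    ring
  rw [hd]
  linarith only [key]

/-- The eliminant `g` for `E₆/A₁` has exactly two real roots, lying in the
indicated intervals. -/
theorem e6_a1_eliminant_roots :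
    ∃ a b : ℝ,
      a ∈ Set.Ioo (0.8651 : ℝ) 0.8652 ∧
      b ∈ Set.Ioo (0.9203 : ℝ) 0.9204 ∧
      (∀ t : ℝ,
        40733269776 * t ^ 8 - 95717471616 * t ^ 7 + 80248108328 * t ^ 6 -
          31589680504 * t ^ 5 + 7669961625 * t ^ 4 - 1207801950 * t ^ 3 +
          120201725 * t ^ 2 - 5089500 * t + 422500 = 0 ↔
        t = a ∨ t = b) := by
  have hcont : Continuous eliminant := by unfold eliminant; fun_prop
  obtain ⟨a, ha, ha0⟩ := intermediate_value_Ioo' (show (0.8651 : ℝ) ≤ 0.8652 by norm_num)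
    hcont.continuousOn (show (0 : ℝ) ∈ _ by constructor <;> norm_num [eliminant])
  obtain ⟨b, hb, hb0⟩ := intermediate_value_Ioo (show (0.9203 : ℝ) ≤ 0.9204 by norm_num)
    hcont.continuousOn (show (0 : ℝ) ∈ _ by constructor <;> norm_num [eliminant])
  refine ⟨a, b, ha, hb, fun t => ?_⟩
  change eliminant t = 0 ↔ _
  refine ⟨fun ht0 => ?_, ?_⟩
  · have hroot {x : ℝ} (hx : eliminant x = 0) : x ∈ Set.Ici (21 / 25 : ℝ) := by
      by_contra h
      exact (eliminant_pos_of_le (not_le.mp h).le).ne' hx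
    have hthree {x y z : ℝ} (hx : eliminant x = 0) (hy : eliminant y = 0)
        (hz : eliminant z = 0) (hxy : x < y) (hyz : y < z) : False := by
      have := strictConvexOn_eliminant.slope_strict_mono_adjacent (hroot hx) (hroot hz) hxy hyz
      simp [hx, hy, hz] at this
    have hab : a < b := by linarith [ha.2, hb.1]
    by_contra! h
    rcases h.1.lt_or_gt with h1 | h1
    · exact hthree ht0 ha0 hb0 h1 hab
    · rcases h.2.lt_or_gt with h2 | h2
      · exact hthree ha0 ht0 hb0 h1 h2
      · exact hthree ha0 hb0 ht0 hab h2
  · rintro (rfl | rfl) <;> assumption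
end

section
/- There exist positive real numbers u₁, x₁, x₂ with u₁ ∈ (0.1945, 0.1946), x₁ ∈ (0.5189, 0.5190), x₂ ∈ (0.8651, 0.8652) satisfying -5x₁²x₂² - 6x₂²u₁² - x₁²u₁² + 6x₁²u₁ + 6x₂²u₁ = 0, -80x₁x₂² + 10x₂³ + 20x₁² + 21x₂² + 24x₂²u₁ = 0, and -10x₁²x₂ - 5x₂³ + 6x₁² + 5x₂² + 4x₁²u₁ = 0. -/
/-- The Einstein system is solved rationally in `t = x₁ / x₂`, up to one polynomial equation:
with `x₁ = t x₂`, `x₂ = N / D` and `u₁ = U / D`, the last two equations hold identically in `t`. -/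
theorem einstein_system_of_ratio {t N D U u₁ x₁ x₂ : ℝ} (hD : D ≠ 0)
    (hN : N = 4 * t ^ 4 - 3 * t ^ 2 - 6) (hDt : D = 16 * t ^ 3 - 14 * t ^ 2 - 6)
    (hU : U = ((80 * t - 10) * N - (20 * t ^ 2 + 21) * D) / 24)
    (hP : -5 * t ^ 2 * N ^ 2 - (6 + t ^ 2) * U ^ 2 + 6 * (t ^ 2 + 1) * U * D = 0)
    (hu₁ : u₁ = U / D) (hx₁ : x₁ = t * x₂) (hx₂ : x₂ = N / D) :
    -5 * x₁ ^ 2 * x₂ ^ 2 - 6 * x₂ ^ 2 * u₁ ^ 2 - x₁ ^ 2 * u₁ ^ 2 + 6 * x₁ ^ 2 * u₁ +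
        6 * x₂ ^ 2 * u₁ = 0 ∧
      -80 * x₁ * x₂ ^ 2 + 10 * x₂ ^ 3 + 20 * x₁ ^ 2 + 21 * x₂ ^ 2 + 24 * x₂ ^ 2 * u₁ = 0 ∧
      -10 * x₁ ^ 2 * x₂ - 5 * x₂ ^ 3 + 6 * x₁ ^ 2 + 5 * x₂ ^ 2 + 4 * x₁ ^ 2 * u₁ = 0 := by
  have hx : x₂ * D = N := (eq_div_iff hD).mp hx₂
  have hu : u₁ = (80 * t * x₂ - 10 * x₂ - 20 * t ^ 2 - 21) / 24 := by
    rw [hu₁, hx₂, hU]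
    field_simp
    ring
  refine ⟨?_, ?_, ?_⟩
  · have hF : -5 * t ^ 2 * x₂ ^ 2 - (6 + t ^ 2) * u₁ ^ 2 + 6 * (t ^ 2 + 1) * u₁ = 0 := by
      rw [hu₁, hx₂]
      field_simp
      linear_combination hP
    rw [hx₁]
    linear_combination x₂ ^ 2 * hF
  · rw [hx₁, hu]
    ring
  · rw [hN, hDt] at hx
    rw [hx₁, hu]
    linear_combination (5 / 6) * x₂ ^ 2 * hx

/-- The polynomial whose roots are the ratios `x₁ / x₂` of solutions has a root in a short
interval. -/
theorem exists_einstein_ratio :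
    ∃ t ∈ Set.Icc (0.599836 : ℝ) 0.599838, ∃ N D U : ℝ,
      N = 4 * t ^ 4 - 3 * t ^ 2 - 6 ∧ D = 16 * t ^ 3 - 14 * t ^ 2 - 6 ∧
      U = ((80 * t - 10) * N - (20 * t ^ 2 + 21) * D) / 24 ∧
      -5 * t ^ 2 * N ^ 2 - (6 + t ^ 2) * U ^ 2 + 6 * (t ^ 2 + 1) * U * D = 0 := by
  let N : ℝ → ℝ := fun t ↦ 4 * t ^ 4 - 3 * t ^ 2 - 6
  let D : ℝ → ℝ := fun t ↦ 16 * t ^ 3 - 14 * t ^ 2 - 6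
  let U : ℝ → ℝ := fun t ↦ ((80 * t - 10) * N t - (20 * t ^ 2 + 21) * D t) / 24
  let P : ℝ → ℝ := fun t ↦
    -5 * t ^ 2 * N t ^ 2 - (6 + t ^ 2) * U t ^ 2 + 6 * (t ^ 2 + 1) * U t * D t
  have hP : Continuous P := by
    simp only [P, U, N, D]
    fun_prop
  obtain ⟨t, ht, h⟩ := intermediate_value_Icc (a := (0.599836 : ℝ)) (b := 0.599838)
    (by norm_num) hP.continuousOn
    (show (0 : ℝ) ∈ Set.Icc (P 0.599836) (P 0.599838) by
      simp only [P, U, N, D]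
      constructor <;> norm_num)
  exact ⟨t, ht, N t, D t, U t, rfl, rfl, rfl, h⟩

/-- The first positive solution of the Einstein system on `E₆/A₁`. -/
theorem e6_a1_solution_one :
    ∃ u₁ x₁ x₂ : ℝ,
      u₁ ∈ Set.Ioo (0.1945 : ℝ) 0.1946 ∧
      x₁ ∈ Set.Ioo (0.5189 : ℝ) 0.5190 ∧
      x₂ ∈ Set.Ioo (0.8651 : ℝ) 0.8652 ∧
      -5 * x₁ ^ 2 * x₂ ^ 2 - 6 * x₂ ^ 2 * u₁ ^ 2 - x₁ ^ 2 * u₁ ^ 2 + 6 * x₁ ^ 2 * u₁ +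
        6 * x₂ ^ 2 * u₁ = 0 ∧
      -80 * x₁ * x₂ ^ 2 + 10 * x₂ ^ 3 + 20 * x₁ ^ 2 + 21 * x₂ ^ 2 + 24 * x₂ ^ 2 * u₁ = 0 ∧
      -10 * x₁ ^ 2 * x₂ - 5 * x₂ ^ 3 + 6 * x₁ ^ 2 + 5 * x₂ ^ 2 + 4 * x₁ ^ 2 * u₁ = 0 := by
  obtain ⟨t, ⟨hl, hr⟩, N, D, U, hN, hD, hU, hP⟩ := exists_einstein_ratio
  have ht : 0 ≤ t := by linarith
  have hl2 : (0.35980322 : ℝ) ≤ t ^ 2 :=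
    le_trans (by norm_num) (pow_le_pow_left₀ (by norm_num) hl 2)
  have hr2 : t ^ 2 ≤ (0.35980563 : ℝ) :=
    (pow_le_pow_left₀ ht hr 2).trans (by norm_num)
  have hl3 : (0.21582292 : ℝ) ≤ t ^ 3 :=
    le_trans (by norm_num) (pow_le_pow_left₀ (by norm_num) hl 3)
  have hr3 : t ^ 3 ≤ (0.21582509 : ℝ) :=
    (pow_le_pow_left₀ ht hr 3).trans (by norm_num)
  have hl4 : (0.12945836 : ℝ) ≤ t ^ 4 :=
    le_trans (by norm_num) (pow_le_pow_left₀ (by norm_num) hl 4)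
  have hr4 : t ^ 4 ≤ (0.12946009 : ℝ) :=
    (pow_le_pow_left₀ ht hr 4).trans (by norm_num)
  have hl5 : (0.07765378 : ℝ) ≤ t ^ 5 :=
    le_trans (by norm_num) (pow_le_pow_left₀ (by norm_num) hl 5)
  have hr5 : t ^ 5 ≤ (0.07765509 : ℝ) :=
    (pow_le_pow_left₀ ht hr 5).trans (by norm_num)
  have hD0 : D < 0 := by linarith
  have hU' : U = (240 * t ^ 4 - 576 * t ^ 3 + 444 * t ^ 2 - 480 * t + 186) / 24 := by
    rw [hU, hN, hD]
    ring
  have hxN : t * N = 4 * t ^ 5 - 3 * t ^ 3 - 6 * t := by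
    rw [hN]
    ring
  refine ⟨U / D, t * (N / D), N / D, ⟨?_, ?_⟩, ⟨?_, ?_⟩, ⟨?_, ?_⟩,
    einstein_system_of_ratio hD0.ne hN hD hU hP rfl rfl rfl⟩
  · rw [lt_div_iff_of_neg hD0]
    linarith
  · rw [div_lt_iff_of_neg hD0]
    linarith
  · rw [← mul_div_assoc, lt_div_iff_of_neg hD0]
    linarith
  · rw [← mul_div_assoc, div_lt_iff_of_neg hD0]
    linarith
  · rw [lt_div_iff_of_neg hD0]
    linarith
  · rw [div_lt_iff_of_neg hD0]
    linarith
end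

section
/- There exist positive real numbers u₁, x₁, x₂ with u₁ ∈ (0.7881, 0.7882), x₁ ∈ (2.5824, 2.5825), x₂ ∈ (0.9203, 0.9204) satisfying -5x₁²x₂² - 6x₂²u₁² - x₁²u₁² + 6x₁²u₁ + 6x₂²u₁ = 0, -80x₁x₂² + 10x₂³ + 20x₁² + 21x₂² + 24x₂²u₁ = 0, and -10x₁²x₂ - 5x₂³ + 6x₁² + 5x₂² + 4x₁²u₁ = 0. -/
/-- A zero `t = x₁ / x₂` of the eliminant of the Einstein system on `E₆/A₁`. -/
lemma exists_eliminant_root :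
    ∃ t ∈ Set.Icc (2.80601595 : ℝ) 2.80601596,
      -80 * t ^ 6 * (4 * t ^ 4 - 3 * t ^ 2 - 6) ^ 2
        - (6 + t ^ 2) * ((10 * t ^ 2 + 5) * (4 * t ^ 4 - 3 * t ^ 2 - 6)
          - (6 * t ^ 2 + 5) * (16 * t ^ 3 - 14 * t ^ 2 - 6)) ^ 2
        + 24 * t ^ 2 * (t ^ 2 + 1) * ((10 * t ^ 2 + 5) * (4 * t ^ 4 - 3 * t ^ 2 - 6)
          - (6 * t ^ 2 + 5) * (16 * t ^ 3 - 14 * t ^ 2 - 6))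
          * (16 * t ^ 3 - 14 * t ^ 2 - 6) = 0 := by
  have hcont : Continuous fun t : ℝ ↦
      -80 * t ^ 6 * (4 * t ^ 4 - 3 * t ^ 2 - 6) ^ 2
        - (6 + t ^ 2) * ((10 * t ^ 2 + 5) * (4 * t ^ 4 - 3 * t ^ 2 - 6)
          - (6 * t ^ 2 + 5) * (16 * t ^ 3 - 14 * t ^ 2 - 6)) ^ 2
        + 24 * t ^ 2 * (t ^ 2 + 1) * ((10 * t ^ 2 + 5) * (4 * t ^ 4 - 3 * t ^ 2 - 6)
          - (6 * t ^ 2 + 5) * (16 * t ^ 3 - 14 * t ^ 2 - 6))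
          * (16 * t ^ 3 - 14 * t ^ 2 - 6) := by
    fun_prop
  exact intermediate_value_Icc (by norm_num) hcont.continuousOn
    ⟨by norm_num, by norm_num⟩

/-- The second positive solution of the Einstein system on `E₆/A₁`. -/
theorem e6_a1_solution_two :
    ∃ u₁ x₁ x₂ : ℝ,
      u₁ ∈ Set.Ioo (0.7881 : ℝ) 0.7882 ∧
      x₁ ∈ Set.Ioo (2.5824 : ℝ) 2.5825 ∧
      x₂ ∈ Set.Ioo (0.9203 : ℝ) 0.9204 ∧
      -5 * x₁ ^ 2 * x₂ ^ 2 - 6 * x₂ ^ 2 * u₁ ^ 2 - x₁ ^ 2 * u₁ ^ 2 + 6 * x₁ ^ 2 * u₁ +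
        6 * x₂ ^ 2 * u₁ = 0 ∧
      -80 * x₁ * x₂ ^ 2 + 10 * x₂ ^ 3 + 20 * x₁ ^ 2 + 21 * x₂ ^ 2 + 24 * x₂ ^ 2 * u₁ = 0 ∧
      -10 * x₁ ^ 2 * x₂ - 5 * x₂ ^ 3 + 6 * x₁ ^ 2 + 5 * x₂ ^ 2 + 4 * x₁ ^ 2 * u₁ = 0 := by
  obtain ⟨t, ⟨hl, hr⟩, ht⟩ := exists_eliminant_root
  have ht0 : 0 < t := by linarith
  have lower (n : ℕ) : (2.80601595 : ℝ) ^ n ≤ t ^ n := by gcongr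
  have upper (n : ℕ) : t ^ n ≤ (2.80601596 : ℝ) ^ n := by gcongr
  have l2 := lower 2
  have l3 := lower 3
  have l4 := lower 4
  have l5 := lower 5
  have l6 := lower 6
  have r2 := upper 2
  have r3 := upper 3
  have r4 := upper 4
  have r5 := upper 5
  have r6 := upper 6
  norm_num at l2 l3 l4 l5 l6 r2 r3 r4 r5 r6
  obtain ⟨D, hD⟩ : ∃ D, D = 16 * t ^ 3 - 14 * t ^ 2 - 6 := ⟨_, rfl⟩
  obtain ⟨N, hN⟩ : ∃ N, N = 4 * t ^ 4 - 3 * t ^ 2 - 6 := ⟨_, rfl⟩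
  obtain ⟨M, hM⟩ : ∃ M, M = (10 * t ^ 2 + 5) * N - (6 * t ^ 2 + 5) * D := ⟨_, rfl⟩
  rw [← hD, ← hN, ← hM] at ht
  have hDpos : 0 < D := by linarith
  have hEpos : 0 < 4 * t ^ 2 * D := by positivity
  refine ⟨M / (4 * t ^ 2 * D), t * N / D, N / D, ⟨?_, ?_⟩, ⟨?_, ?_⟩, ⟨?_, ?_⟩, ?_, ?_, ?_⟩
  · rw [lt_div_iff₀ hEpos, hM, hN, hD]
    linarith
  · rw [div_lt_iff₀ hEpos, hM, hN, hD]
    linarith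
  · rw [lt_div_iff₀ hDpos, hN, hD]
    linarith
  · rw [div_lt_iff₀ hDpos, hN, hD]
    linarith
  · rw [lt_div_iff₀ hDpos, hN, hD]
    linarith
  · rw [div_lt_iff₀ hDpos, hN, hD]
    linarith
  · have key : -5 * (t * N / D) ^ 2 * (N / D) ^ 2 - 6 * (N / D) ^ 2 * (M / (4 * t ^ 2 * D)) ^ 2
        - (t * N / D) ^ 2 * (M / (4 * t ^ 2 * D)) ^ 2
        + 6 * (t * N / D) ^ 2 * (M / (4 * t ^ 2 * D))
        + 6 * (N / D) ^ 2 * (M / (4 * t ^ 2 * D))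
        = N ^ 2 / (16 * t ^ 4 * D ^ 4) * (-80 * t ^ 6 * N ^ 2 - (6 + t ^ 2) * M ^ 2
          + 24 * t ^ 2 * (t ^ 2 + 1) * M * D) := by
      field_simp
      ring
    rw [key, ht, mul_zero]
  · have key : -80 * (t * N / D) * (N / D) ^ 2 + 10 * (N / D) ^ 3 + 20 * (t * N / D) ^ 2
        + 21 * (N / D) ^ 2 + 24 * (N / D) ^ 2 * (M / (4 * t ^ 2 * D))
        = N ^ 2 / (t ^ 2 * D ^ 3) * (-80 * t ^ 3 * N + 10 * t ^ 2 * N + 20 * t ^ 4 * D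
          + 21 * t ^ 2 * D + 6 * M) := by
      field_simp
      ring
    rw [key, hM, hN, hD]
    ring
  · rw [hM]
    field_simp
    ring
end

section
/- Every real root of the polynomial f(t) = 27263765625t⁸ - 82709987500t⁷ + 94104102500t⁶ - 48116787500t⁵ + 9948352750t⁴ - 491681700t³ + 74376100t² - 1183780t + 142129 lies in the open interval (0, 1). -/
/-- Every real root of the eliminant `f` for `E₆/A₄` lies in `(0, 1)`. -/
theorem e6_a4_eliminant_roots_in_unit_interval (t : ℝ)
    (h : 27263765625 * t ^ 8 - 82709987500 * t ^ 7 + 94104102500 * t ^ 6 -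
      48116787500 * t ^ 5 + 9948352750 * t ^ 4 - 491681700 * t ^ 3 +
      74376100 * t ^ 2 - 1183780 * t + 142129 = 0) :
    t ∈ Set.Ioo (0 : ℝ) 1 := by
  constructor
  · -- For `t ≤ 0` the alternating signs make every term nonnegative.
    by_contra! ht
    obtain ⟨s, rfl⟩ : ∃ s, t = -s := ⟨-t, by ring⟩
    have hs : 0 ≤ s := by linarith
    have hpos : 0 < 27263765625 * s ^ 8 + 82709987500 * s ^ 7 + 94104102500 * s ^ 6 +
        48116787500 * s ^ 5 + 9948352750 * s ^ 4 + 491681700 * s ^ 3 +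
        74376100 * s ^ 2 + 1183780 * s + 142129 := by positivity
    exact hpos.ne' (by linear_combination h)
  · -- The Taylor coefficients at `1` are all positive.
    by_contra! ht
    obtain ⟨s, rfl⟩ : ∃ s, t = 1 + s := ⟨t - 1, by ring⟩
    have hs : 0 ≤ s := by linarith
    have hpos : 0 < 27263765625 * s ^ 8 + 135400137500 * s ^ 7 + 278519627500 * s ^ 6 +
        306368965000 * s ^ 5 + 194539984000 * s ^ 4 + 72137216800 * s ^ 3 +
        15158810000 * s ^ 2 + 1646824320 * s + 71098624 := by positivity
    exact hpos.ne' (by linear_combination h)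
end

section
/- Every real root of the polynomial g(t) = 40733269776t⁸ - 95717471616t⁷ + 80248108328t⁶ - 31589680504t⁵ + 7669961625t⁴ - 1207801950t³ + 120201725t² - 5089500t + 422500 lies in the open interval (0, 1). -/
/-- Every real root of the eliminant `g` for `E₆/A₁` lies in `(0, 1)`. -/
theorem e6_a1_eliminant_roots_in_unit_interval (t : ℝ)
    (h : 40733269776 * t ^ 8 - 95717471616 * t ^ 7 + 80248108328 * t ^ 6 -
      31589680504 * t ^ 5 + 7669961625 * t ^ 4 - 1207801950 * t ^ 3 +
      120201725 * t ^ 2 - 5089500 * t + 422500 = 0) :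
    t ∈ Set.Ioo (0 : ℝ) 1 := by
  constructor
  · -- The coefficients of `g` alternate in sign, so `g (-s) > 0` for `s ≥ 0`.
    by_contra! ht
    obtain ⟨s, rfl⟩ : ∃ s, t = -s := ⟨-t, by ring⟩
    have hs : 0 ≤ s := by linarith
    have hpos : 0 < 40733269776 * s ^ 8 + 95717471616 * s ^ 7 + 80248108328 * s ^ 6 +
        31589680504 * s ^ 5 + 7669961625 * s ^ 4 + 1207801950 * s ^ 3 +
        120201725 * s ^ 2 + 5089500 * s + 422500 := by positivity
    linarith
  · -- The Taylor coefficients of `g` at `1` are positive, so `g (s + 1) > 0` for `s ≥ 0`.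
    by_contra! ht
    obtain ⟨s, rfl⟩ : ∃ s, t = s + 1 := ⟨t - 1, by ring⟩
    have hs : 0 ≤ s := by linarith
    have hpos : 0 < 40733269776 * s ^ 8 + 230148686592 * s ^ 7 + 550757360744 * s ^ 6 +
        720895172984 * s ^ 5 + 554660561785 * s ^ 4 + 249489006966 * s ^ 3 +
        60806035297 * s ^ 2 + 6675858944 * s + 251920384 := by positivity
    linarith
end

section
/- Let x₁ > 0 and x₂ > 0 satisfy -10x₁²x₂ - 5x₂³ + 6x₁² + 5x₂² = 0. Then x₂ < 3/5 or x₂ ≤ 1, and in fact 0 < x₂ < 1; moreover x₁² = (5x₂³ - 5x₂²)/(6 - 10x₂) whenever x₂ ≠ 3/5. -/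
/-- Positivity of `x₁²` in the equation `r̃_{h₀} = r̃_{m₂}` (in polynomial form)
forces the parameter `x₂` into the interval `(0, 1)`, and away from `x₂ = 3/5`
one can solve for `x₁²`. -/
theorem e6_a4_x2_in_unit_interval (x₁ x₂ : ℝ) (hx₁ : 0 < x₁) (hx₂ : 0 < x₂)
    (h : -10 * x₁ ^ 2 * x₂ - 5 * x₂ ^ 3 + 6 * x₁ ^ 2 + 5 * x₂ ^ 2 = 0) :
    (x₂ < 3 / 5 ∨ x₂ ≤ 1) ∧ (0 < x₂ ∧ x₂ < 1) ∧
      (x₂ ≠ 3 / 5 → x₁ ^ 2 = (5 * x₂ ^ 3 - 5 * x₂ ^ 2) / (6 - 10 * x₂)) := by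
  have hlt : x₂ < 1 := by
    by_contra! hge
    have hpos : 0 < x₁ ^ 2 * (10 * x₂ - 6) := mul_pos (pow_pos hx₁ 2) (by linarith)
    have hnonneg : 0 ≤ x₂ ^ 2 * (x₂ - 1) := mul_nonneg (sq_nonneg x₂) (by linarith)
    linarith
  refine ⟨Or.inr hlt.le, ⟨hx₂, hlt⟩, fun hne => ?_⟩
  have hden : 6 - 10 * x₂ ≠ 0 := fun h0 => hne (by linarith)
  rw [eq_div_iff hden]
  linarith
end
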